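/- arXiv:0704.1041 — 2 statements merged into one kernel-verified Lean document; each statement's English description precedes it below -/
import Mathlib

section
/- For no dimension N ≥ 2 do there exist three distinct integers k_1, k_2, k_3 with 1 ≤ k_1 < k_2 < k_3 ≤ N − 1 such that the centroids C_{k_1,N}, C_{k_2,N}, C_{k_3,N} of the corresponding skeletons of the standard simplex in ℝ^N all coincide. -/
open MeasureTheory

/-- The vertices of the standard simplex in `ℝ^N`: the origin together with the standard
basis vectors `e_1, …, e_N`. -/
noncomputable def simplexVertex (N : ℕ) (i : Fin (N + 1)) : EuclideanSpace ℝ (Fin N) :=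
  if h : i = 0 then 0 else EuclideanSpace.single (i.pred h) 1

/-- The `k`-skeleton of the standard simplex in `ℝ^N`: the union of the convex hulls of
all `(k+1)`-element subsets of the vertex set `{0, e_1, …, e_N}`. -/
def simplexSkeleton (N k : ℕ) : Set (EuclideanSpace ℝ (Fin N)) :=
  ⋃ s ∈ {s : Finset (Fin (N + 1)) | s.card = k + 1}, convexHull ℝ (simplexVertex N '' ↑s)

/-- The centroid `C_{k,N}` of the `k`-skeleton of the standard simplex in `ℝ^N`: the
vector-valued integral of the identity over the skeleton with respect to `k`-dimensional
Hausdorff measure, divided by the total `k`-dimensional Hausdorff measure of the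
skeleton. -/
noncomputable def skeletonCentroid (N k : ℕ) : EuclideanSpace ℝ (Fin N) :=
  (μH[(k : ℝ)] (simplexSkeleton N k)).toReal⁻¹ •
    ∫ x in simplexSkeleton N k, x ∂(μH[(k : ℝ)])

/-- The barycentric coordinates of a point of `ℝ^N` with respect to `0, e_1, …, e_N`. -/
def baryCoord {N : ℕ} (x : EuclideanSpace ℝ (Fin N)) : Fin (N + 1) → ℝ :=
  Fin.cons (1 - ∑ i, x i) fun i => x i

@[simp]
theorem baryCoord_zero {N : ℕ} (x : EuclideanSpace ℝ (Fin N)) :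
    baryCoord x 0 = 1 - ∑ i, x i := rfl

@[simp]
theorem baryCoord_succ {N : ℕ} (x : EuclideanSpace ℝ (Fin N)) (i : Fin N) :
    baryCoord x i.succ = x i := rfl

theorem sum_baryCoord {N : ℕ} (x : EuclideanSpace ℝ (Fin N)) : ∑ i, baryCoord x i = 1 := by
  simp [Fin.sum_univ_succ]

theorem continuous_baryCoord {N : ℕ} (i : Fin (N + 1)) :
    Continuous fun x : EuclideanSpace ℝ (Fin N) => baryCoord x i := by
  refine Fin.cases ?_ (fun j => ?_) i
  · simp only [baryCoord_zero]; fun_prop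
  · simp only [baryCoord_succ]; fun_prop

theorem baryCoord_injective {N : ℕ} :
    Function.Injective (baryCoord : EuclideanSpace ℝ (Fin N) → Fin (N + 1) → ℝ) := by
  intro x y h
  ext i
  simpa using congrFun h i.succ

theorem sum_sq_baryCoord_sub {N : ℕ} (x y : EuclideanSpace ℝ (Fin N)) :
    ∑ i, (baryCoord x i - baryCoord y i) ^ 2 =
      (baryCoord x 0 - baryCoord y 0) ^ 2 + dist x y ^ 2 := by
  rw [EuclideanSpace.dist_sq_eq, Fin.sum_univ_succ]
  simp [Real.dist_eq]

theorem baryCoord_smul_add_smul {N : ℕ} (x y : EuclideanSpace ℝ (Fin N)) {a b : ℝ}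
    (hab : a + b = 1) (i : Fin (N + 1)) :
    baryCoord (a • x + b • y) i = a * baryCoord x i + b * baryCoord y i := by
  refine Fin.cases ?_ (fun j => ?_) i
  · simp [Finset.sum_add_distrib, ← Finset.mul_sum]
    linear_combination -hab
  · simp

theorem baryCoord_simplexVertex {N : ℕ} (i j : Fin (N + 1)) :
    baryCoord (simplexVertex N i) j = if j = i then 1 else 0 := by
  refine Fin.cases ?_ (fun i => ?_) i <;> refine Fin.cases ?_ (fun j => ?_) j <;>
    simp [simplexVertex, Fin.succ_ne_zero, (Fin.succ_ne_zero _).symm, PiLp.single_apply]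

theorem sum_baryCoord_smul_simplexVertex {N : ℕ} (x : EuclideanSpace ℝ (Fin N)) :
    ∑ i, baryCoord x i • simplexVertex N i = x := by
  ext j
  simp [Fin.sum_univ_succ, simplexVertex, Fin.succ_ne_zero, Pi.single_apply]

/-- A face of the simplex, described by the signs of the barycentric coordinates. -/
theorem convexHull_simplexVertex {N : ℕ} (s : Finset (Fin (N + 1))) :
    convexHull ℝ (simplexVertex N '' ↑s) =
      {x | (∀ i, 0 ≤ baryCoord x i) ∧ ∀ i ∉ s, baryCoord x i = 0} := by
  apply Set.Subset.antisymm
  · refine convexHull_min ?_ ?_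
    · rintro _ ⟨i, hi, rfl⟩
      refine ⟨fun j => ?_, fun j hj => ?_⟩
      · rw [baryCoord_simplexVertex]; split_ifs <;> norm_num
      · rw [baryCoord_simplexVertex, if_neg]
        rintro rfl
        exact hj hi
    · rintro x ⟨hx, hx'⟩ y ⟨hy, hy'⟩ a b ha hb hab
      refine ⟨fun i => ?_, fun i hi => ?_⟩
      · rw [baryCoord_smul_add_smul x y hab]
        exact add_nonneg (mul_nonneg ha (hx i)) (mul_nonneg hb (hy i))
      · rw [baryCoord_smul_add_smul x y hab, hx' i hi, hy' i hi]; simp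
  · rintro x ⟨hx, hx'⟩
    have h0 : ∑ i ∈ s, baryCoord x i • simplexVertex N i = x := by
      conv_rhs => rw [← sum_baryCoord_smul_simplexVertex x]
      exact Finset.sum_subset (Finset.subset_univ s) fun i _ hi => by rw [hx' i hi, zero_smul]
    have h1 : ∑ i ∈ s, baryCoord x i = 1 := by
      rw [← sum_baryCoord x]
      exact Finset.sum_subset (Finset.subset_univ s) fun i _ hi => hx' i hi
    rw [← h0]
    exact (convex_convexHull ℝ _).sum_mem (fun i _ => hx i) h1
      fun i hi => subset_convexHull ℝ _ ⟨i, hi, rfl⟩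

/-- The solid standard simplex. -/
def solidSimplex (k : ℕ) : Set (EuclideanSpace ℝ (Fin k)) := {x | ∀ i, 0 ≤ baryCoord x i}

/-- The affine map of `ℝ^k` to `ℝ^N` that sends the vertices of the standard simplex of `ℝ^k` to
the vertices of the standard simplex of `ℝ^N` as prescribed by `f`. -/
noncomputable def faceMap {k N : ℕ} (f : Fin (k + 1) → Fin (N + 1))
    (x : EuclideanSpace ℝ (Fin k)) : EuclideanSpace ℝ (Fin N) :=
  WithLp.toLp 2 fun j => ∑ l, if f l = j.succ then baryCoord x l else 0

theorem baryCoord_faceMap {k N : ℕ} (f : Fin (k + 1) → Fin (N + 1))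
    (x : EuclideanSpace ℝ (Fin k)) (i : Fin (N + 1)) :
    baryCoord (faceMap f x) i = ∑ l, if f l = i then baryCoord x l else 0 := by
  have hsucc : ∀ j : Fin N, baryCoord (faceMap f x) j.succ =
      ∑ l, if f l = j.succ then baryCoord x l else 0 := fun j => rfl
  refine Fin.cases ?_ hsucc i
  have h1 : ∑ i, ∑ l, (if f l = i then baryCoord x l else 0) = 1 := by
    rw [Finset.sum_comm]
    simpa using sum_baryCoord x
  have h2 := sum_baryCoord (faceMap f x)
  rw [Fin.sum_univ_succ] at h1 h2
  simp only [hsucc] at h2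
  linarith

theorem baryCoord_faceMap_apply {k N : ℕ} {f : Fin (k + 1) → Fin (N + 1)}
    (hf : Function.Injective f) (x : EuclideanSpace ℝ (Fin k)) (l : Fin (k + 1)) :
    baryCoord (faceMap f x) (f l) = baryCoord x l := by
  simp [baryCoord_faceMap, hf.eq_iff]

theorem baryCoord_faceMap_of_notMem {k N : ℕ} {f : Fin (k + 1) → Fin (N + 1)}
    (x : EuclideanSpace ℝ (Fin k)) {i : Fin (N + 1)} (hi : i ∉ Set.range f) :
    baryCoord (faceMap f x) i = 0 := by
  rw [baryCoord_faceMap]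
  exact Finset.sum_eq_zero fun l _ => if_neg fun h => hi ⟨l, h⟩

theorem continuous_faceMap {k N : ℕ} (f : Fin (k + 1) → Fin (N + 1)) :
    Continuous (faceMap f) := by
  unfold faceMap
  refine (PiLp.continuous_toLp 2 _).comp
    (continuous_pi fun j => continuous_finsetSum _ fun l _ => ?_)
  split_ifs
  exacts [continuous_baryCoord l, continuous_const]

theorem faceMap_dist_sq {k N : ℕ} {f : Fin (k + 1) → Fin (N + 1)}
    (hf : Function.Injective f) (x y : EuclideanSpace ℝ (Fin k)) :
    (baryCoord (faceMap f x) 0 - baryCoord (faceMap f y) 0) ^ 2 +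
        dist (faceMap f x) (faceMap f y) ^ 2 =
      (baryCoord x 0 - baryCoord y 0) ^ 2 + dist x y ^ 2 := by
  rw [← sum_sq_baryCoord_sub, ← sum_sq_baryCoord_sub]
  have h := Finset.sum_subset (Finset.subset_univ (Finset.univ.image f))
    (f := fun i => (baryCoord (faceMap f x) i - baryCoord (faceMap f y) i) ^ 2) fun i _ hi => by
      have hi : i ∉ Set.range f := by simpa using hi
      simp [baryCoord_faceMap_of_notMem _ hi]
  rw [← h, Finset.sum_image fun a _ b _ hab => hf hab]
  simp only [baryCoord_faceMap_apply hf]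

theorem subset_range_faceMap {k N : ℕ} {f : Fin (k + 1) → Fin (N + 1)}
    (hf : Function.Injective f) {s : Finset (Fin (N + 1))} (hs : Set.range f = s) :
    convexHull ℝ (simplexVertex N '' ↑s) ⊆ Set.range (faceMap f) := by
  rw [convexHull_simplexVertex]
  rintro x ⟨-, hx⟩
  refine ⟨WithLp.toLp 2 fun j => baryCoord x (f j.succ), baryCoord_injective ?_⟩
  have hsum : ∑ l, baryCoord x (f l) = 1 := by
    rw [← sum_baryCoord x, ← Finset.sum_image (f := baryCoord x) (g := f) fun a _ b _ hab => hf hab]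
    refine Finset.sum_subset (Finset.subset_univ _) fun i _ hi => hx i fun h => ?_
    obtain ⟨l, rfl⟩ : i ∈ Set.range f := hs ▸ h
    simp at hi
  have hb : baryCoord (WithLp.toLp 2 fun j : Fin k => baryCoord x (f j.succ)) =
      fun l => baryCoord x (f l) := by
    funext l
    refine Fin.cases ?_ (fun j => rfl) l
    rw [Fin.sum_univ_succ] at hsum
    simp only [baryCoord_zero]
    linarith
  funext i
  by_cases hi : i ∈ Set.range f
  · obtain ⟨l, rfl⟩ := hi
    rw [baryCoord_faceMap_apply hf, hb]
  · rw [baryCoord_faceMap_of_notMem _ hi, hx i fun h => hi (hs ▸ h)]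

theorem faceMap_preimage {k N : ℕ} {f : Fin (k + 1) → Fin (N + 1)}
    (hf : Function.Injective f) {s : Finset (Fin (N + 1))} (hs : Set.range f = s) :
    faceMap f ⁻¹' convexHull ℝ (simplexVertex N '' ↑s) = solidSimplex k := by
  rw [convexHull_simplexVertex]
  ext x
  constructor
  · rintro ⟨h, -⟩ l
    rw [← baryCoord_faceMap_apply hf]
    exact h _
  · intro h
    refine ⟨fun i => ?_, fun i hi => baryCoord_faceMap_of_notMem x fun h => hi ?_⟩
    · by_cases hi : i ∈ Set.range f
      · obtain ⟨l, rfl⟩ := hi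
        rw [baryCoord_faceMap_apply hf]
        exact h l
      · rw [baryCoord_faceMap_of_notMem x hi]
    · rwa [hs] at h

instance isAddHaarMeasure_hausdorffMeasure_euclideanSpace (k : ℕ) :
    (μH[(k : ℝ)] : Measure (EuclideanSpace ℝ (Fin k))).IsAddHaarMeasure := by
  simpa using isAddHaarMeasure_hausdorffMeasure (E := EuclideanSpace ℝ (Fin k))

/-- If a map distorts distances like an invertible linear map of `ℝ^k` does, then the Hausdorff
measure on its range is the image of that on `ℝ^k`, scaled by the determinant. -/
theorem hausdorffMeasure_restrict_range {k : ℕ} {Y : Type*} [MetricSpace Y] [MeasurableSpace Y]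
    [BorelSpace Y] {φ : EuclideanSpace ℝ (Fin k) → Y}
    {M : EuclideanSpace ℝ (Fin k) →ₗ[ℝ] EuclideanSpace ℝ (Fin k)} (hM : LinearMap.det M ≠ 0)
    (hφ : ∀ x y, dist (φ x) (φ y) = dist (M x) (M y)) :
    (μH[(k : ℝ)] : Measure Y).restrict (Set.range φ) =
      ENNReal.ofReal |LinearMap.det M| • Measure.map φ μH[(k : ℝ)] := by
  set e := M.equivOfDetNeZero hM with he
  have heM : ∀ x, e x = M x := fun x => rfl
  have hU : Isometry (φ ∘ e.symm) := by
    refine Isometry.of_dist_eq fun x y => ?_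
    simp only [Function.comp_apply, hφ, ← heM, LinearEquiv.apply_symm_apply]
  have hφU : (φ ∘ e.symm) ∘ M = φ := by
    funext x
    simp [← heM]
  have hrange : Set.range φ = Set.range (φ ∘ e.symm) := (e.symm.surjective.range_comp φ).symm
  have hMm : Measurable M := M.continuous_of_finiteDimensional.measurable
  have h := Measure.map_linearMap_addHaar_eq_smul_addHaar
    (μH[(k : ℝ)] : Measure (EuclideanSpace ℝ (Fin k))) hM
  rw [hrange, ← hU.map_hausdorffMeasure (Or.inl (by positivity))]
  conv_rhs => rw [← hφU, ← Measure.map_map hU.continuous.measurable hMm, h, Measure.map_smul]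
  rw [smul_smul, ← ENNReal.ofReal_mul (abs_nonneg _), ← abs_mul, mul_inv_cancel₀ hM]
  simp

theorem measurableSet_solidSimplex (k : ℕ) : MeasurableSet (solidSimplex k) := by
  have : solidSimplex k = ⋂ i, {x | 0 ≤ baryCoord x i} := by ext; simp [solidSimplex]
  rw [this]
  exact MeasurableSet.iInter fun i =>
    (isClosed_le continuous_const (continuous_baryCoord i)).measurableSet

theorem isCompact_solidSimplex (k : ℕ) : IsCompact (solidSimplex k) := by
  have h : solidSimplex k =
      convexHull ℝ (simplexVertex k '' ↑(Finset.univ : Finset (Fin (k + 1)))) := by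
    rw [convexHull_simplexVertex]
    simp [solidSimplex]
  rw [h]
  exact (Finset.univ.finite_toSet.image _).isCompact_convexHull ℝ

theorem hausdorffMeasure_solidSimplex_pos (k : ℕ) : 0 < μH[(k : ℝ)] (solidSimplex k) := by
  have hopen : IsOpen {x : EuclideanSpace ℝ (Fin k) | ∀ i, 0 < baryCoord x i} := by
    simp only [Set.ofPred_forall]
    exact isOpen_iInter_of_finite fun i => isOpen_lt continuous_const (continuous_baryCoord i)
  refine (hopen.measure_pos _ ⟨WithLp.toLp 2 fun _ => 1 / ((k : ℝ) + 1), ?_⟩).trans_le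
    (measure_mono fun x hx i => (hx i).le)
  intro i
  have hk : (0 : ℝ) < k + 1 := by positivity
  refine Fin.cases ?_ (fun i => ?_) i
  · have : (k : ℝ) * ((k : ℝ) + 1)⁻¹ < 1 := by
      rw [mul_inv_lt_iff₀ hk]; linarith
    simpa using this
  · simpa using hk

theorem hausdorffMeasure_solidSimplex_lt_top (k : ℕ) : μH[(k : ℝ)] (solidSimplex k) < ⊤ :=
  (isCompact_solidSimplex k).measure_lt_top

/-- There is a measure-preserving map of `ℝ^k` that exchanges the barycentric coordinates `0` and
`i + 1`. -/
theorem exists_measurePreserving_swap {k : ℕ} (i : Fin k) :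
    ∃ ψ : EuclideanSpace ℝ (Fin k) → EuclideanSpace ℝ (Fin k),
      MeasurePreserving ψ μH[(k : ℝ)] μH[(k : ℝ)] ∧
      ∀ x j, baryCoord (ψ x) j = baryCoord x (Equiv.swap 0 i.succ j) := by
  let f : Module.Dual ℝ (EuclideanSpace ℝ (Fin k)) :=
    { toFun := fun x => -(x i) - ∑ j, x j
      map_add' := fun x y => by simp [Finset.sum_add_distrib]; ring
      map_smul' := fun c x => by simp [← Finset.mul_sum]; ring }
  have hf : ∀ x, f x = -(x i) - ∑ j, x j := fun x => rfl
  let e : EuclideanSpace ℝ (Fin k) := EuclideanSpace.single i 1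
  have hdet : LinearMap.det (LinearMap.transvection f e) = -1 := by
    rw [LinearMap.transvection.det, hf]
    norm_num [e]
  have hL : MeasurePreserving (LinearMap.transvection f e) μH[(k : ℝ)] μH[(k : ℝ)] := by
    refine ⟨(LinearMap.continuous_of_finiteDimensional _).measurable, ?_⟩
    rw [Measure.map_linearMap_addHaar_eq_smul_addHaar _ (by rw [hdet]; norm_num), hdet]
    simp
  refine ⟨_, (measurePreserving_add_right _ e).comp hL, fun x j => ?_⟩
  have hval : ∀ j, (LinearMap.transvection f e x + e) j =
      if j = i then baryCoord x 0 else x j := by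
    intro j
    by_cases h : j = i
    · subst h
      simp [LinearMap.transvection.apply, hf, e]
      ring
    · simp [LinearMap.transvection.apply, hf, e, h]
  refine Fin.cases ?_ (fun j => ?_) j
  · rw [baryCoord_zero, Equiv.swap_apply_left]
    simp only [Function.comp_apply, hval]
    rw [Finset.sum_ite, Finset.filter_eq' , if_pos (Finset.mem_univ _), Finset.sum_singleton,
      Finset.filter_ne', baryCoord_zero, ← Finset.add_sum_erase _ _ (Finset.mem_univ i)]
    simp
  · rw [baryCoord_succ]
    simp only [Function.comp_apply, hval]
    by_cases h : j = i
    · subst h; simp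
    · rw [if_neg h, Equiv.swap_apply_of_ne_of_ne (Fin.succ_ne_zero _)
        (fun h' => h (Fin.succ_injective _ h')), baryCoord_succ]

theorem integral_baryCoord_zero_solidSimplex (k : ℕ) :
    ∫ x in solidSimplex k, baryCoord x 0 ∂μH[(k : ℝ)] =
      (μH[(k : ℝ)] (solidSimplex k)).toReal / (k + 1) := by
  have hswap : ∀ i : Fin (k + 1), ∫ x in solidSimplex k, baryCoord x i ∂μH[(k : ℝ)] =
      ∫ x in solidSimplex k, baryCoord x 0 ∂μH[(k : ℝ)] := by
    refine Fin.cases rfl fun i => ?_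
    obtain ⟨ψ, hψ, hb⟩ := exists_measurePreserving_swap i
    have hpre : ψ ⁻¹' solidSimplex k = solidSimplex k := by
      ext x
      simp only [solidSimplex, Set.mem_preimage, Set.mem_ofPred_eq, hb]
      exact ⟨fun h j => by simpa using h (Equiv.swap 0 i.succ j), fun h j => h _⟩
    conv_lhs => rw [← hψ.map_eq]
    rw [setIntegral_map (measurableSet_solidSimplex k)
      (continuous_baryCoord _).aestronglyMeasurable hψ.measurable.aemeasurable, hpre]
    simp [hb]
  have hsum : ∑ i : Fin (k + 1), ∫ x in solidSimplex k, baryCoord x i ∂μH[(k : ℝ)] =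
      (μH[(k : ℝ)] (solidSimplex k)).toReal := by
    rw [← integral_finsetSum _ fun i _ =>
      ((continuous_baryCoord i).continuousOn.integrableOn_compact (isCompact_solidSimplex k))]
    simp [sum_baryCoord, Measure.real, -baryCoord_zero]
  simp only [hswap, Finset.sum_const, Finset.card_univ, Fintype.card_fin, nsmul_eq_mul] at hsum
  rw [eq_div_iff (by positivity), ← hsum]
  push_cast
  ring

theorem hausdorffMeasure_baryCoord_eq_zero {k : ℕ} (hk : 1 ≤ k) (l : Fin (k + 1)) :
    μH[(k : ℝ)] {x : EuclideanSpace ℝ (Fin k) | baryCoord x l = 0} = 0 := by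
  have hsucc : ∀ i : Fin k,
      μH[(k : ℝ)] {x : EuclideanSpace ℝ (Fin k) | baryCoord x i.succ = 0} = 0 := by
    intro i
    have h := Measure.addHaar_submodule (μH[(k : ℝ)] : Measure (EuclideanSpace ℝ (Fin k)))
      (LinearMap.ker (EuclideanSpace.proj i : EuclideanSpace ℝ (Fin k) →L[ℝ] ℝ).toLinearMap) ?_
    · exact h
    · intro h
      have : EuclideanSpace.single i (1 : ℝ) ∈ LinearMap.ker
          (EuclideanSpace.proj i : EuclideanSpace ℝ (Fin k) →L[ℝ] ℝ).toLinearMap := h ▸ trivial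
      simp at this
  refine Fin.cases ?_ hsucc l
  obtain ⟨ψ, hψ, hb⟩ := exists_measurePreserving_swap (⟨0, hk⟩ : Fin k)
  have hm := hψ.measure_preimage ((isClosed_eq (continuous_baryCoord (Fin.succ ⟨0, hk⟩))
    continuous_const).measurableSet.nullMeasurableSet (s := {x | baryCoord x _ = 0}))
  rw [hsucc] at hm
  simpa [hb, Set.preimage_ofPred_eq, -baryCoord_zero] using hm

/-- The ratio of the volume of a `k`-dimensional face of the simplex to that of the standard
simplex of `ℝ^k`. -/
noncomputable def faceScale {N : ℕ} (k : ℕ) (s : Finset (Fin (N + 1))) : ℝ :=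
  if 0 ∈ s then 1 else √(k + 1)

theorem faceScale_pos {N : ℕ} (k : ℕ) (s : Finset (Fin (N + 1))) : 0 < faceScale k s := by
  unfold faceScale
  split_ifs <;> positivity

/-- The linear map `1 + α J` of `ℝ^k`, with `J` the all-ones matrix and `α` such that its square
is `1 + J`. -/
theorem exists_linearMap_norm_sq_eq (k : ℕ) :
    ∃ M : EuclideanSpace ℝ (Fin k) →ₗ[ℝ] EuclideanSpace ℝ (Fin k),
      LinearMap.det M = √(k + 1) ∧ ∀ x, ‖M x‖ ^ 2 = ‖x‖ ^ 2 + (∑ i, x i) ^ 2 := by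
  have hs : √((k : ℝ) + 1) ^ 2 = k + 1 := Real.sq_sqrt (by positivity)
  have hpos : 0 ≤ √((k : ℝ) + 1) := Real.sqrt_nonneg _
  set t := √((k : ℝ) + 1)
  let f : Module.Dual ℝ (EuclideanSpace ℝ (Fin k)) :=
    { toFun := fun x => ∑ j, x j
      map_add' := fun x y => by simp [Finset.sum_add_distrib]
      map_smul' := fun c x => by simp [← Finset.mul_sum] }
  have hf : ∀ x, f x = ∑ j, x j := fun x => rfl
  set α := 1 / (t + 1) with hα
  let v : EuclideanSpace ℝ (Fin k) := WithLp.toLp 2 fun _ => α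
  have hαt : α * (t + 1) = 1 := by rw [hα]; field_simp
  refine ⟨LinearMap.transvection f v, ?_, fun x => ?_⟩
  · rw [LinearMap.transvection.det, hf]
    simp only [v, Finset.sum_const, Finset.card_univ, Fintype.card_fin, nsmul_eq_mul]
    linear_combination (t - 1) * hαt - α * hs
  · rw [LinearMap.transvection.apply, hf, EuclideanSpace.real_norm_sq_eq,
      EuclideanSpace.real_norm_sq_eq]
    have hi : ∀ i, (x + (∑ j, x j) • v) i ^ 2 =
        x i ^ 2 + 2 * α * (∑ j, x j) * x i + (α * ∑ j, x j) ^ 2 := by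
      intro i
      simp [v]
      ring
    simp only [hi, Finset.sum_add_distrib, ← Finset.mul_sum, Finset.sum_const, Finset.card_univ,
      Fintype.card_fin, nsmul_eq_mul]
    have h : 2 * α + k * α ^ 2 = 1 := by
      linear_combination (α * (t - 1) + 1) * hαt - α ^ 2 * hs
    linear_combination (∑ j, x j) ^ 2 * h

/-- Each `k`-dimensional face is parametrized by the standard simplex of `ℝ^k`, with constant
Jacobian. -/
theorem exists_restrict_face_eq_map {N k : ℕ} {s : Finset (Fin (N + 1))} (hs : s.card = k + 1) :
    ∃ f : Fin (k + 1) → Fin (N + 1), Function.Injective f ∧ Set.range f = s ∧ (0 ∈ s → f 0 = 0) ∧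
      (μH[(k : ℝ)]).restrict (convexHull ℝ (simplexVertex N '' ↑s)) =
        ENNReal.ofReal (faceScale k s) •
          Measure.map (faceMap f) ((μH[(k : ℝ)]).restrict (solidSimplex k)) := by
  set f := s.orderEmbOfFin hs
  have hinj : Function.Injective f := f.injective
  have hrange : Set.range f = s := s.range_orderEmbOfFin hs
  have hzero : 0 ∈ s → f 0 = 0 := by
    intro h0
    obtain ⟨l, hl⟩ : 0 ∈ Set.range f := hrange ▸ h0
    exact le_antisymm (hl ▸ f.monotone (Fin.zero_le l)) (Fin.zero_le _)
  refine ⟨f, hinj, hrange, hzero, ?_⟩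
  obtain ⟨M, hM, hdist⟩ : ∃ M : EuclideanSpace ℝ (Fin k) →ₗ[ℝ] EuclideanSpace ℝ (Fin k),
      LinearMap.det M = faceScale k s ∧
        ∀ x y, dist (faceMap f x) (faceMap f y) = dist (M x) (M y) := by
    by_cases h0 : 0 ∈ s
    · refine ⟨LinearMap.id, by simp [faceScale, h0], fun x y => ?_⟩
      have h := faceMap_dist_sq hinj x y
      have hb : ∀ x, baryCoord (faceMap f x) 0 = baryCoord x 0 := fun x => by
        have := baryCoord_faceMap_apply hinj x 0
        rwa [hzero h0] at this
      rw [hb, hb, add_right_inj] at h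
      exact (pow_left_inj₀ dist_nonneg dist_nonneg two_ne_zero).1 h
    · obtain ⟨M, hdet, hM⟩ := exists_linearMap_norm_sq_eq k
      refine ⟨M, by simp [faceScale, h0, hdet], fun x y => ?_⟩
      have h := faceMap_dist_sq hinj x y
      have hb : ∀ x, baryCoord (faceMap f x) 0 = 0 := fun x =>
        baryCoord_faceMap_of_notMem x fun h => h0 (by rwa [hrange] at h)
      refine (pow_left_inj₀ dist_nonneg dist_nonneg two_ne_zero).1 ?_
      rw [dist_eq_norm (M x), ← map_sub, hM, ← dist_eq_norm]
      rw [hb, hb] at h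
      simp only [baryCoord_zero] at h
      simp only [PiLp.sub_apply, Finset.sum_sub_distrib]
      linear_combination h
  have hpos := faceScale_pos k s
  have hmeas : MeasurableSet (convexHull ℝ (simplexVertex N '' (s : Set (Fin (N + 1))))) :=
    ((s.finite_toSet.image _).isCompact_convexHull ℝ).measurableSet
  rw [← Measure.restrict_restrict_of_subset (subset_range_faceMap hinj hrange),
    hausdorffMeasure_restrict_range (hM ▸ hpos.ne') hdist, Measure.restrict_smul,
    Measure.restrict_map (continuous_faceMap _).measurable hmeas, faceMap_preimage hinj hrange,
    hM, abs_of_pos hpos]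

theorem aedisjoint_face {N k : ℕ} (hk : 1 ≤ k) {s t : Finset (Fin (N + 1))}
    (hs : s.card = k + 1) (ht : t.card = k + 1) (hst : s ≠ t) :
    AEDisjoint μH[(k : ℝ)] (convexHull ℝ (simplexVertex N '' (s : Set (Fin (N + 1)))))
      (convexHull ℝ (simplexVertex N '' (t : Set (Fin (N + 1))))) := by
  obtain ⟨f, hf, hrange, -, hmap⟩ := exists_restrict_face_eq_map hs
  obtain ⟨i, his, hit⟩ : ∃ i ∈ s, i ∉ t :=
    Finset.not_subset.1 fun h => hst (Finset.eq_of_subset_of_card_le h (by omega))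
  obtain ⟨l, rfl⟩ : i ∈ Set.range f := hrange ▸ his
  have hmeas : MeasurableSet {x : EuclideanSpace ℝ (Fin N) | baryCoord x (f l) = 0} :=
    (isClosed_eq (continuous_baryCoord _) continuous_const).measurableSet
  refine measure_mono_null (t := {x | baryCoord x (f l) = 0} ∩
    convexHull ℝ (simplexVertex N '' (s : Set (Fin (N + 1))))) ?_ ?_
  · rintro x ⟨hxs, hxt⟩
    rw [convexHull_simplexVertex] at hxt
    exact ⟨hxt.2 _ hit, hxs⟩
  · rw [← Measure.restrict_apply hmeas, hmap, Measure.smul_apply,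
      Measure.map_apply (continuous_faceMap f).measurable hmeas]
    have : (μH[(k : ℝ)]).restrict (solidSimplex k)
        (faceMap f ⁻¹' {x | baryCoord x (f l) = 0}) = 0 := by
      refine Measure.absolutelyContinuous_of_le Measure.restrict_le_self ?_
      simpa [Set.preimage_ofPred_eq, baryCoord_faceMap_apply hf] using
        hausdorffMeasure_baryCoord_eq_zero hk l
    rw [this, smul_zero]

theorem hausdorffMeasure_face {N k : ℕ} {s : Finset (Fin (N + 1))} (hs : s.card = k + 1) :
    μH[(k : ℝ)] (convexHull ℝ (simplexVertex N '' (s : Set (Fin (N + 1))))) =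
      ENNReal.ofReal (faceScale k s) * μH[(k : ℝ)] (solidSimplex k) := by
  obtain ⟨f, -, -, -, hmap⟩ := exists_restrict_face_eq_map hs
  have h := congrArg (fun μ => μ Set.univ) hmap
  simpa [Measure.map_apply (continuous_faceMap f).measurable MeasurableSet.univ] using h

theorem integral_baryCoord_zero_face {N k : ℕ} {s : Finset (Fin (N + 1))}
    (hs : s.card = k + 1) :
    ∫ x in convexHull ℝ (simplexVertex N '' (s : Set (Fin (N + 1)))), baryCoord x 0 ∂μH[(k : ℝ)] =
      if 0 ∈ s then (μH[(k : ℝ)] (solidSimplex k)).toReal / (k + 1) else 0 := by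
  obtain ⟨f, hf, hrange, h0, hmap⟩ := exists_restrict_face_eq_map hs
  rw [hmap, integral_smul_measure, integral_map (continuous_faceMap f).measurable.aemeasurable
    (continuous_baryCoord _).aestronglyMeasurable]
  split_ifs with h
  · have hb : ∀ x, baryCoord (faceMap f x) 0 = baryCoord x 0 := fun x => by
      have := baryCoord_faceMap_apply hf x 0
      rwa [h0 h] at this
    simp only [hb, integral_baryCoord_zero_solidSimplex]
    simp [faceScale, h]
  · have hb : ∀ x, baryCoord (faceMap f x) 0 = 0 := fun x =>
      baryCoord_faceMap_of_notMem x fun h' => h (by rwa [hrange] at h')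
    simp [hb, -baryCoord_zero]

theorem isCompact_simplexSkeleton (N k : ℕ) : IsCompact (simplexSkeleton N k) :=
  (Set.toFinite _).isCompact_biUnion fun s _ => (s.finite_toSet.image _).isCompact_convexHull ℝ

theorem restrict_simplexSkeleton (N : ℕ) {k : ℕ} (hk : 1 ≤ k) :
    (μH[(k : ℝ)]).restrict (simplexSkeleton N k) =
      ∑ s ∈ Finset.powersetCard (k + 1) (Finset.univ : Finset (Fin (N + 1))),
        (μH[(k : ℝ)]).restrict (convexHull ℝ (simplexVertex N '' ↑s)) := by
  have h : simplexSkeleton N k = ⋃ s : {s : Finset (Fin (N + 1)) // s.card = k + 1},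
      convexHull ℝ (simplexVertex N '' ↑s.1) := by
    rw [simplexSkeleton, Set.biUnion_eq_iUnion]
    rfl
  rw [h, Measure.restrict_iUnion_ae, Measure.sum_fintype]
  · exact (Finset.sum_subtype (p := fun s : Finset (Fin (N + 1)) => s.card = k + 1) _
      (fun s => Finset.mem_powersetCard_univ) fun s : Finset (Fin (N + 1)) =>
      (μH[(k : ℝ)]).restrict (convexHull ℝ (simplexVertex N '' (s : Set (Fin (N + 1)))))).symm
  · exact fun s t hst => aedisjoint_face hk s.2 t.2 fun h => hst (Subtype.ext h)
  · exact fun s =>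
      ((s.1.finite_toSet.image _).isCompact_convexHull ℝ).measurableSet.nullMeasurableSet

theorem sum_powersetCard_univ_ite_zero_mem (N k : ℕ) (a b : ℝ) :
    ∑ s ∈ Finset.powersetCard (k + 1) (Finset.univ : Finset (Fin (N + 1))),
      (if 0 ∈ s then a else b) = N.choose k * a + N.choose (k + 1) * b := by
  have hmem : (0 : Fin (N + 1)) ∉ Finset.univ.erase (0 : Fin (N + 1)) := Finset.notMem_erase _ _
  have hcard : (Finset.univ.erase (0 : Fin (N + 1))).card = N := by simp
  rw [← Finset.insert_erase (Finset.mem_univ (0 : Fin (N + 1))),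
    Finset.powersetCard_succ_insert hmem, Finset.sum_union, Finset.sum_image, add_comm]
  · congr 1
    · rw [Finset.sum_congr rfl fun s _ => if_pos (Finset.mem_insert_self 0 s)]
      simp
    · rw [Finset.sum_congr rfl fun s hs =>
        if_neg fun h => hmem ((Finset.mem_powersetCard.1 hs).1 h)]
      simp
  · intro s hs t ht hst
    have hs' : 0 ∉ s := fun h => hmem ((Finset.mem_powersetCard.1 hs).1 h)
    have ht' : 0 ∉ t := fun h => hmem ((Finset.mem_powersetCard.1 ht).1 h)
    rw [← Finset.erase_insert hs', hst, Finset.erase_insert ht']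
  · rw [Finset.disjoint_left]
    intro s hs hs'
    obtain ⟨t, -, rfl⟩ := Finset.mem_image.1 hs'
    exact hmem ((Finset.mem_powersetCard.1 hs).1 (Finset.mem_insert_self 0 t))

theorem hausdorffMeasure_simplexSkeleton (N : ℕ) {k : ℕ} (hk : 1 ≤ k) :
    μH[(k : ℝ)] (simplexSkeleton N k) =
      ENNReal.ofReal (N.choose k + N.choose (k + 1) * √(k + 1)) *
        μH[(k : ℝ)] (solidSimplex k) := by
  have h := congrArg (fun μ => μ Set.univ) (restrict_simplexSkeleton N hk)
  simp only [Measure.restrict_apply_univ, Measure.finsetSum_apply] at h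
  rw [h, Finset.sum_congr rfl fun s hs => hausdorffMeasure_face (Finset.mem_powersetCard.1 hs).2,
    ← Finset.sum_mul, ← ENNReal.ofReal_sum_of_nonneg fun s _ => (faceScale_pos k s).le]
  simp only [faceScale, sum_powersetCard_univ_ite_zero_mem, mul_one]

theorem integrableOn_simplexSkeleton (N : ℕ) {k : ℕ} (hk : 1 ≤ k) {E : Type*}
    [NormedAddCommGroup E] [SecondCountableTopologyEither (EuclideanSpace ℝ (Fin N)) E]
    {g : EuclideanSpace ℝ (Fin N) → E} (hg : Continuous g) :
    IntegrableOn g (simplexSkeleton N k) μH[(k : ℝ)] := by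
  obtain ⟨C, hC⟩ := (isCompact_simplexSkeleton N k).exists_bound_of_continuousOn hg.continuousOn
  refine IntegrableOn.of_bound (C := C) ?_ hg.aestronglyMeasurable
    ((ae_restrict_iff' (isCompact_simplexSkeleton N k).measurableSet).2 (.of_forall hC))
  rw [hausdorffMeasure_simplexSkeleton N hk]
  exact ENNReal.mul_lt_top ENNReal.ofReal_lt_top (hausdorffMeasure_solidSimplex_lt_top k)

theorem integral_baryCoord_zero_simplexSkeleton (N : ℕ) {k : ℕ} (hk : 1 ≤ k) :
    ∫ x in simplexSkeleton N k, baryCoord x 0 ∂μH[(k : ℝ)] =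
      N.choose k * ((μH[(k : ℝ)] (solidSimplex k)).toReal / (k + 1)) := by
  rw [restrict_simplexSkeleton N hk, integral_finsetSum_measure, Finset.sum_congr rfl
    fun s hs => integral_baryCoord_zero_face (Finset.mem_powersetCard.1 hs).2,
    sum_powersetCard_univ_ite_zero_mem, mul_zero, add_zero]
  intro s hs
  exact (integrableOn_simplexSkeleton N hk (continuous_baryCoord 0)).mono_set
    (Set.subset_biUnion_of_mem (u := fun s : Finset (Fin (N + 1)) =>
      convexHull ℝ (simplexVertex N '' (s : Set (Fin (N + 1)))))
      (Finset.mem_powersetCard.1 hs).2)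

/-- The barycentric coordinate of the centroid of the `k`-skeleton with respect to the origin. -/
theorem baryCoord_zero_skeletonCentroid {N k : ℕ} (hk : 1 ≤ k) (hkN : k ≤ N) :
    baryCoord (skeletonCentroid N k) 0 = 1 / (k + 1 + (N - k) * √(k + 1)) := by
  set m := (μH[(k : ℝ)] (simplexSkeleton N k)).toReal with hm
  set V := (μH[(k : ℝ)] (solidSimplex k)).toReal with hV
  have hVpos : 0 < V := ENNReal.toReal_pos (hausdorffMeasure_solidSimplex_pos k).ne'
    (hausdorffMeasure_solidSimplex_lt_top k).ne
  have hs : 0 < √((k : ℝ) + 1) := by positivity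
  have hc : (0 : ℝ) < N.choose k := by exact_mod_cast Nat.choose_pos hkN
  have hmV : m = (N.choose k + N.choose (k + 1) * √(k + 1)) * V := by
    rw [hm, hausdorffMeasure_simplexSkeleton N hk, ENNReal.toReal_mul,
      ENNReal.toReal_ofReal (by positivity)]
  have hmpos : 0 < m := by rw [hmV]; positivity
  let ℓ : EuclideanSpace ℝ (Fin N) →L[ℝ] ℝ := ∑ i, EuclideanSpace.proj i
  have hℓ : ∀ x, ℓ x = ∑ i, x i := fun x => by simp [ℓ]
  have hb : ∀ x, baryCoord x 0 = 1 - ℓ x := fun x => by rw [hℓ]; rfl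
  have hint : ∫ x in simplexSkeleton N k, baryCoord x 0 ∂μH[(k : ℝ)] =
      m - ℓ (∫ x in simplexSkeleton N k, x ∂μH[(k : ℝ)]) := by
    have hcomm := ℓ.integral_comp_comm (integrableOn_simplexSkeleton N hk continuous_id)
    simp only [id] at hcomm
    simp only [hb]
    rw [← hcomm, integral_sub (integrableOn_simplexSkeleton N hk continuous_const)
      (integrableOn_simplexSkeleton N hk ℓ.continuous)]
    simp [hm, Measure.real]
  have hbc : baryCoord (skeletonCentroid N k) 0 =
      m⁻¹ * ∫ x in simplexSkeleton N k, baryCoord x 0 ∂μH[(k : ℝ)] := by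
    rw [hint, hb, skeletonCentroid, map_smul, smul_eq_mul, ← hm, mul_sub, inv_mul_cancel₀ hmpos.ne']
  have hchoose : (N.choose (k + 1) : ℝ) * (k + 1) = N.choose k * (N - k) := by
    have := Nat.choose_succ_right_eq N k
    rw [← Nat.cast_sub hkN]
    exact_mod_cast this
  have hNk : (0 : ℝ) ≤ N - k := sub_nonneg.2 (by exact_mod_cast hkN)
  have hden : (0 : ℝ) < k + 1 + (N - k) * √(k + 1) := by positivity
  rw [hbc, integral_baryCoord_zero_simplexSkeleton N hk, ← hV, inv_mul_eq_div,
    div_eq_div_iff hmpos.ne' hden.ne', hmV]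
  field_simp
  linear_combination (-√((k : ℝ) + 1)) * hchoose

/-- The three points at which a cubic `c + a t + t² - t³` takes the same value add up to one. -/
theorem add_add_eq_one_of_cubic_eq {a t₁ t₂ t₃ : ℝ} (h₁₂ : t₁ ≠ t₂) (h₂₃ : t₂ ≠ t₃) (h₁₃ : t₁ ≠ t₃)
    (e₁₂ : a * t₁ + t₁ ^ 2 - t₁ ^ 3 = a * t₂ + t₂ ^ 2 - t₂ ^ 3)
    (e₂₃ : a * t₂ + t₂ ^ 2 - t₂ ^ 3 = a * t₃ + t₃ ^ 2 - t₃ ^ 3) :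
    t₁ + t₂ + t₃ = 1 := by
  have f₁₂ : a + (t₁ + t₂) - (t₁ ^ 2 + t₁ * t₂ + t₂ ^ 2) = 0 :=
    mul_left_cancel₀ (sub_ne_zero.2 h₁₂) (by linear_combination e₁₂)
  have f₂₃ : a + (t₂ + t₃) - (t₂ ^ 2 + t₂ * t₃ + t₃ ^ 2) = 0 :=
    mul_left_cancel₀ (sub_ne_zero.2 h₂₃) (by linear_combination e₂₃)
  exact mul_left_cancel₀ (sub_ne_zero.2 h₁₃) (by linear_combination f₂₃ - f₁₂)

theorem cubic_eq_of_skeletonCentroid_eq {N k l : ℕ} (hk : 1 ≤ k) (hkN : k ≤ N) (hl : 1 ≤ l)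
    (hlN : l ≤ N) (h : skeletonCentroid N k = skeletonCentroid N l) :
    (N + 1) * √(k + 1) + √(k + 1) ^ 2 - √(k + 1) ^ 3 =
      (N + 1) * √(l + 1) + √(l + 1) ^ 2 - √(l + 1) ^ 3 := by
  have hb := congrArg (fun x => baryCoord x 0) h
  simp only [baryCoord_zero_skeletonCentroid hk hkN, baryCoord_zero_skeletonCentroid hl hlN,
    one_div, inv_inj] at hb
  have hsk : √((k : ℝ) + 1) ^ 2 = k + 1 := Real.sq_sqrt (by positivity)
  have hsl : √((l : ℝ) + 1) ^ 2 = l + 1 := Real.sq_sqrt (by positivity)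
  linear_combination hb + (1 - √((k : ℝ) + 1)) * hsk - (1 - √((l : ℝ) + 1)) * hsl

/-- For no dimension `N ≥ 2` do there exist three distinct intermediate skeletons of the
standard simplex in `ℝ^N` whose centroids all coincide. -/
theorem no_three_coincident_centroids (N : ℕ) (hN : 2 ≤ N) :
    ¬ ∃ k₁ k₂ k₃ : ℕ, 1 ≤ k₁ ∧ k₁ < k₂ ∧ k₂ < k₃ ∧ k₃ ≤ N - 1 ∧
      skeletonCentroid N k₁ = skeletonCentroid N k₂ ∧
      skeletonCentroid N k₂ = skeletonCentroid N k₃ := by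
  rintro ⟨k₁, k₂, k₃, h₁, h₁₂, h₂₃, h₃, e₁₂, e₂₃⟩
  have hlt : ∀ {k l : ℕ}, k < l → √((k : ℝ) + 1) < √((l : ℝ) + 1) := fun {k l} h =>
    Real.sqrt_lt_sqrt (by positivity) (by exact_mod_cast Nat.succ_lt_succ h)
  have hone : ∀ k : ℕ, 1 ≤ √((k : ℝ) + 1) := fun k => Real.one_le_sqrt.2 (by simp)
  have hsum := add_add_eq_one_of_cubic_eq (hlt h₁₂).ne (hlt h₂₃).ne (hlt (h₁₂.trans h₂₃)).ne
    (cubic_eq_of_skeletonCentroid_eq h₁ (by omega) (by omega) (by omega) e₁₂)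
    (cubic_eq_of_skeletonCentroid_eq (by omega) (by omega) (by omega) (by omega) e₂₃)
  linarith [hone k₁, hone k₂, hone k₃]
end

section
/- Let T be a nondegenerate triangle in the Euclidean plane with vertices A, B, C. Then the average of the three vertices always equals the centroid of the solid triangle (the integral of the identity over the convex hull of {A, B, C} with respect to 2-dimensional Lebesgue measure divided by the area). Moreover, the centroid of the edges (the integral of the identity over the union of the three edges with respect to 1-dimensional Hausdorff measure divided by the total perimeter) equals this common point if and only if the triangle is equilateral. -/
open MeasureTheory

theorem AffineIndependent.linearIndependent_sub_sub {V : Type*} [AddCommGroup V] [Module ℝ V]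
    {A B C : V} (h : AffineIndependent ℝ ![A, B, C]) : LinearIndependent ℝ ![B - A, C - A] := by
  have h1 := (affineIndependent_iff_linearIndependent_vsub ℝ _ (0 : Fin 3)).1 h
  have h2 := h1.comp (fun i : Fin 2 => ⟨i.succ, Fin.succ_ne_zero i⟩)
    (fun i j hij => by simpa using hij)
  convert! h2 using 1
  ext i
  fin_cases i <;> simp

theorem AffineIndependent.rotate_three {V : Type*} [AddCommGroup V] [Module ℝ V]
    {A B C : V} (h : AffineIndependent ℝ ![A, B, C]) : AffineIndependent ℝ ![B, C, A] := by
  rw [affineIndependent_iff_not_collinear_set] at h ⊢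
  rwa [Set.insert_comm B C, Set.pair_comm B A, Set.insert_comm C A, Set.pair_comm C B]

section InvariantAverage

variable {E : Type*} [NormedAddCommGroup E] [NormedSpace ℝ E] [FiniteDimensional ℝ E]
  [MeasurableSpace E]

/-- The barycenter of a finite measure is fixed by every affine map preserving the measure. -/
theorem AffineMap.map_average_of_measurePreserving {ν : Measure E} [IsFiniteMeasure ν] [NeZero ν]
    {φ : E →ᵃ[ℝ] E} (hφ : MeasurePreserving φ ν ν) (hν : Integrable (fun x : E => x) ν) :
    φ (⨍ x, x ∂ν) = ⨍ x, x ∂ν := by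
  have hL : ∀ x, φ x = φ.linear.toContinuousLinearMap x + φ 0 := fun x => by
    simpa using congrFun φ.decomp x
  have key : ∫ x, φ x ∂ν = ∫ x, x ∂ν := by
    have h := integral_map (f := fun x : E => x) hφ.measurable.aemeasurable
      (by rw [hφ.map_eq]; exact hν.1)
    rw [hφ.map_eq] at h
    exact h.symm
  have hne : ν.real Set.univ ≠ 0 := by
    simpa [Measure.real, ENNReal.toReal_eq_zero_iff] using NeZero.ne ν
  have hcongr : ∫ x, φ x ∂ν = ∫ x, (φ.linear.toContinuousLinearMap x + φ 0) ∂ν :=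
    integral_congr_ae (Filter.Eventually.of_forall hL)
  rw [hcongr] at key
  rw [integral_add (ContinuousLinearMap.integrable_comp _ hν) (integrable_const _),
    ContinuousLinearMap.integral_comp_comm _ hν, integral_const] at key
  rw [hL, average_eq, map_smul, ← inv_smul_smul₀ hne (φ 0), ← smul_add, key]

variable [BorelSpace E]

/-- An affine map that maps a set of positive finite Haar measure onto itself preserves Haar
measure. -/
theorem AffineMap.measurePreserving_of_image_eq {μ : Measure E} [μ.IsAddHaarMeasure] {S : Set E}
    (h0 : μ S ≠ 0) (htop : μ S ≠ ⊤) {φ : E →ᵃ[ℝ] E} (hφ : φ '' S = S) :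
    Function.Injective φ ∧ MeasurePreserving φ μ μ := by
  have hL : ⇑φ = (fun x => φ 0 + x) ∘ φ.linear := by
    funext x
    simpa [add_comm] using congrFun φ.decomp x
  have hdet : ENNReal.ofReal |LinearMap.det φ.linear| = 1 := by
    have h : μ (φ '' S) = ENNReal.ofReal |LinearMap.det φ.linear| * μ S := by
      rw [hL, Set.image_comp, Set.image_add_left, measure_preimage_add,
        Measure.addHaar_image_linearMap]
    rw [hφ] at h
    exact ((ENNReal.mul_eq_right h0 htop).1 h.symm)
  have hdet' : |LinearMap.det φ.linear| = 1 := by simpa using hdet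
  have hne : LinearMap.det φ.linear ≠ 0 := by
    intro h
    simp [h] at hdet'
  constructor
  · rw [← AffineMap.linear_injective_iff]
    exact (LinearMap.equivOfDetNeZero φ.linear hne).injective
  · have hlin : MeasurePreserving φ.linear μ μ :=
      ⟨φ.linear.continuous_of_finiteDimensional.measurable, by
        rw [Measure.map_linearMap_addHaar_eq_smul_addHaar μ hne, abs_inv, hdet']
        simp⟩
    rw [hL]
    exact (measurePreserving_add_left μ (φ 0)).comp hlin

/-- The centroid of a compact set of positive volume is fixed by every affine map that maps the
set onto itself. -/
theorem AffineMap.map_setAverage_of_image_eq {μ : Measure E} [μ.IsAddHaarMeasure] {S : Set E}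
    (hS : IsCompact S) (h0 : μ S ≠ 0) {φ : E →ᵃ[ℝ] E} (hφ : φ '' S = S) :
    φ (⨍ x in S, x ∂μ) = ⨍ x in S, x ∂μ := by
  obtain ⟨hinj, hmp⟩ := φ.measurePreserving_of_image_eq h0 hS.measure_ne_top hφ
  have hpre : φ ⁻¹' S = S := by
    conv_lhs => rw [← hφ]
    exact Set.preimage_image_eq S hinj
  have hres := hmp.restrict_preimage hS.measurableSet
  rw [hpre] at hres
  have : IsFiniteMeasure (μ.restrict S) := isFiniteMeasure_restrict.2 hS.measure_ne_top
  have : NeZero (μ.restrict S) := ⟨by simpa using h0⟩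
  exact φ.map_average_of_measurePreserving hres (continuousOn_id.integrableOn_compact hS)

/-- The centroid of a nondegenerate solid triangle is the average of its vertices. -/
theorem setAverage_convexHull_triangle (μ : Measure E) [μ.IsAddHaarMeasure]
    (hE : Module.finrank ℝ E = 2) {A B C : E} (h : AffineIndependent ℝ ![A, B, C]) :
    ⨍ x in convexHull ℝ {A, B, C}, x ∂μ = (3 : ℝ)⁻¹ • (A + B + C) := by
  have hrange : Set.range ![A, B, C] = {A, B, C} := by
    simp only [Matrix.range_cons, Matrix.range_empty, Set.union_empty, Set.singleton_union]
  have hspan : affineSpan ℝ {A, B, C} = ⊤ := by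
    rw [← hrange, h.affineSpan_eq_top_iff_card_eq_finrank_add_one, hE, Fintype.card_fin]
  have hcompact : IsCompact (convexHull ℝ {A, B, C}) :=
    (Set.toFinite {A, B, C}).isCompact_convexHull ℝ
  have h0 : μ (convexHull ℝ {A, B, C}) ≠ 0 :=
    (Measure.measure_pos_of_nonempty_interior μ
      (interior_convexHull_nonempty_iff_affineSpan_eq_top.2 hspan)).ne'
  have hli := h.linearIndependent_sub_sub
  let b := basisOfLinearIndependentOfCardEqFinrank hli (by simp [hE])
  let L : E →ₗ[ℝ] E := b.constr ℝ ![C - B, A - B]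
  have hLu : L (B - A) = C - B := by
    have hb : b 0 = B - A := by simp [b]
    rw [← hb]
    exact b.constr_basis ℝ ![C - B, A - B] 0
  have hLv : L (C - A) = A - B := by
    have hb : b 1 = C - A := by simp [b]
    rw [← hb]
    exact b.constr_basis ℝ ![C - B, A - B] 1
  let φ : E →ᵃ[ℝ] E := L.toAffineMap + AffineMap.const ℝ E (B - L A)
  have hφ : ∀ x, φ x = B + L (x - A) := fun x => by
    simp only [φ, AffineMap.coe_add, Pi.add_apply, LinearMap.coe_toAffineMap,
      AffineMap.const_apply, map_sub]
    abel
  have himage : φ '' convexHull ℝ {A, B, C} = convexHull ℝ {A, B, C} := by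
    rw [AffineMap.image_convexHull]
    congr 1
    rw [Set.image_insert_eq, Set.image_pair, hφ, hφ, hφ, hLu, hLv, sub_self, map_zero, add_zero,
      add_sub_cancel, add_sub_cancel]
    ext x
    simp only [Set.mem_insert_iff, Set.mem_singleton_iff]
    tauto
  have hfix := AffineMap.map_setAverage_of_image_eq hcompact h0 himage
  set G := ⨍ x in convexHull ℝ {A, B, C}, x ∂μ
  rw [hφ] at hfix
  have hL1 : L (G - A) = G - B := by rw [eq_sub_iff_add_eq, add_comm, hfix]
  have hL2 : L (G - B) = G - C := by
    rw [← sub_sub_sub_cancel_right G B A, map_sub, hL1, hLu]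
    abel
  have hLuv : L (C - B) = A - C := by
    rw [← sub_sub_sub_cancel_right C B A, map_sub, hLu, hLv]
    abel
  have hLneg : L (A - B) = B - C := by rw [← neg_sub, map_neg, hLu, neg_sub]
  have hid : LinearMap.id + L + L ∘ₗ L = 0 := b.ext fun i => by
    fin_cases i
    · simp [b, -map_sub, hLu, hLuv]
    · simp [b, -map_sub, hLv, hLneg]
  have hsum : (G - A) + (G - B) + (G - C) = 0 := by
    simpa [-map_sub, hL1, hL2] using LinearMap.congr_fun hid (G - A)
  rw [eq_inv_smul_iff₀ three_ne_zero]
  rw [← sub_eq_zero, ← hsum]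
  module

end InvariantAverage

theorem measurableSet_segment {E : Type*} [NormedAddCommGroup E] [NormedSpace ℝ E]
    [MeasurableSpace E] [BorelSpace E] (A B : E) : MeasurableSet (segment ℝ A B) := by
  rw [← convexHull_pair]
  exact ((Set.toFinite {A, B}).isCompact_convexHull ℝ).measurableSet

section Segment

variable {E : Type*} [NormedAddCommGroup E] [NormedSpace ℝ E] [MeasurableSpace E] [BorelSpace E]

theorem integrableOn_id_segment_hausdorffMeasure [FiniteDimensional ℝ E] (A B : E) :
    IntegrableOn (fun x : E => x) (segment ℝ A B) μH[1] := by
  obtain ⟨M, hM⟩ :=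
    ((Set.toFinite {A, B}).isCompact_convexHull ℝ).isBounded.exists_norm_le
  rw [convexHull_pair] at hM
  refine IntegrableOn.of_bound (C := M) ?_ measurable_id.aestronglyMeasurable ?_
  · rw [hausdorffMeasure_segment]
    exact edist_lt_top A B
  · exact (ae_restrict_mem (measurableSet_segment A B)).mono hM

/-- The integral of the identity over a segment with respect to arc length. -/
theorem setIntegral_id_segment_hausdorffMeasure [FiniteDimensional ℝ E] (A B : E) :
    ∫ x in segment ℝ A B, x ∂μH[1] = dist A B • midpoint ℝ A B := by
  rcases eq_or_ne A B with rfl | hAB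
  · have hμ : (μH[1] : Measure E) (segment ℝ A A) = 0 := by
      rw [hausdorffMeasure_segment, edist_self]
    rw [Measure.restrict_eq_zero.2 hμ, integral_zero_measure, dist_self, zero_smul]
  have hμ : (μH[1] : Measure E) (segment ℝ A B) = edist A B := hausdorffMeasure_segment A B
  have : IsFiniteMeasure ((μH[1] : Measure E).restrict (segment ℝ A B)) :=
    isFiniteMeasure_restrict.2 (by rw [hμ]; exact edist_ne_top A B)
  have : NeZero ((μH[1] : Measure E).restrict (segment ℝ A B)) :=
    ⟨by simpa [hμ] using hAB⟩
  let R := AffineIsometryEquiv.pointReflection ℝ (midpoint ℝ A B)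
  have hR : R ⁻¹' segment ℝ A B = segment ℝ A B := by
    have himage : R '' segment ℝ A B = segment ℝ A B := by
      refine (image_segment ℝ (R.toAffineEquiv : E →ᵃ[ℝ] E) A B).trans ?_
      change segment ℝ (R A) (R B) = _
      rw [AffineIsometryEquiv.pointReflection_midpoint_left,
        AffineIsometryEquiv.pointReflection_midpoint_right, segment_symm]
    conv_lhs => rw [← himage]
    exact Set.preimage_image_eq _ R.injective
  have hmp := (R.toIsometryEquiv.measurePreserving_hausdorffMeasure 1).restrict_preimage
    (measurableSet_segment A B)
  have hpre : R.toIsometryEquiv ⁻¹' segment ℝ A B = segment ℝ A B := hR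
  rw [hpre] at hmp
  have hfix := AffineMap.map_average_of_measurePreserving
    (φ := (R.toAffineEquiv : E →ᵃ[ℝ] E)) hmp (integrableOn_id_segment_hausdorffMeasure A B)
  have hmid : ⨍ x in segment ℝ A B, x ∂μH[1] = midpoint ℝ A B :=
    (AffineIsometryEquiv.pointReflection_fixed_iff (𝕜 := ℝ)).1 hfix
  rw [← hmid, dist_edist, ← hμ]
  exact (measure_smul_setAverage _ (by rw [hμ]; exact edist_ne_top A B)).symm

theorem aedisjoint_segment_hausdorffMeasure {A B C : E} (h : AffineIndependent ℝ ![A, B, C]) :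
    AEDisjoint (μH[1] : Measure E) (segment ℝ A B) (segment ℝ C A) := by
  have := Measure.nullSingletonClass_hausdorff E one_pos
  rw [AEDisjoint, segment_symm ℝ C A,
    segment_inter_eq_endpoint_of_linearIndependent_sub ℝ h.linearIndependent_sub_sub]
  exact measure_singleton A

/-- The length of a triangle is its perimeter, and the integral of the identity over its edges is
the sum of the midpoints weighted by the side lengths. -/
theorem hausdorffMeasure_and_setIntegral_id_triangle [FiniteDimensional ℝ E] {A B C : E}
    (h : AffineIndependent ℝ ![A, B, C]) :
    (μH[1] (segment ℝ A B ∪ segment ℝ B C ∪ segment ℝ C A)).toReal =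
        dist A B + dist B C + dist C A ∧
      ∫ x in segment ℝ A B ∪ segment ℝ B C ∪ segment ℝ C A, x ∂μH[1] =
        dist A B • midpoint ℝ A B + dist B C • midpoint ℝ B C + dist C A • midpoint ℝ C A := by
  have hAB : AEDisjoint (μH[1] : Measure E) (segment ℝ A B) (segment ℝ B C) :=
    (aedisjoint_segment_hausdorffMeasure h.rotate_three).symm
  have hCA : AEDisjoint (μH[1] : Measure E) (segment ℝ A B ∪ segment ℝ B C) (segment ℝ C A) :=
    (aedisjoint_segment_hausdorffMeasure h).union_left
      (aedisjoint_segment_hausdorffMeasure h.rotate_three.rotate_three).symm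
  have hI := integrableOn_id_segment_hausdorffMeasure (E := E)
  have hm := fun A B : E => (measurableSet_segment A B).nullMeasurableSet (μ := μH[1])
  constructor
  · rw [measure_union₀ (hm C A) hCA, measure_union₀ (hm B C) hAB, hausdorffMeasure_segment,
      hausdorffMeasure_segment, hausdorffMeasure_segment,
      ENNReal.toReal_add (by finiteness) (by finiteness),
      ENNReal.toReal_add (by finiteness) (by finiteness), ← dist_edist, ← dist_edist,
      ← dist_edist]
  · rw [setIntegral_union₀ hCA (hm C A) ((hI A B).union (hI B C)) (hI C A),
      setIntegral_union₀ hAB (hm B C) (hI A B) (hI B C), setIntegral_id_segment_hausdorffMeasure,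
      setIntegral_id_segment_hausdorffMeasure, setIntegral_id_segment_hausdorffMeasure]

end Segment

/-- Let `A B C` be the vertices of a nondegenerate triangle in the Euclidean plane.
The average of the vertices equals the centroid of the solid triangle (the integral of
the identity over the convex hull with respect to Lebesgue measure divided by the area);
and the centroid of the union of the three edges (computed with one-dimensional
Hausdorff measure) equals this common point if and only if the triangle is
equilateral. -/
theorem triangle_centroids (A B C : EuclideanSpace ℝ (Fin 2))
    (h : AffineIndependent ℝ ![A, B, C]) :
    (volume (convexHull ℝ ({A, B, C} : Set (EuclideanSpace ℝ (Fin 2))))).toReal⁻¹ •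
        (∫ x in convexHull ℝ ({A, B, C} : Set (EuclideanSpace ℝ (Fin 2))), x) =
      (3 : ℝ)⁻¹ • (A + B + C) ∧
    ((μH[1] (segment ℝ A B ∪ segment ℝ B C ∪ segment ℝ C A)).toReal⁻¹ •
          (∫ x in segment ℝ A B ∪ segment ℝ B C ∪ segment ℝ C A, x ∂(μH[1])) =
        (3 : ℝ)⁻¹ • (A + B + C) ↔
      dist A B = dist B C ∧ dist B C = dist C A) := by
  refine ⟨?_, ?_⟩
  · rw [← setAverage_convexHull_triangle volume (by simp) h, setAverage_eq]
    rfl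
  obtain ⟨hlen, hint⟩ := hausdorffMeasure_and_setIntegral_id_triangle h
  rw [hlen, hint]
  have hne : A ≠ B := fun hAB => by simpa using h.injective.ne (show (0 : Fin 3) ≠ 1 by decide) hAB
  have hP : 0 < dist A B + dist B C + dist C A := by
    have := dist_pos.2 hne
    positivity
  have hli := LinearIndependent.pair_iff.1 h.linearIndependent_sub_sub
  set c := dist A B
  set a := dist B C
  set b := dist C A
  rw [inv_smul_eq_iff₀ hP.ne', ← sub_eq_zero]
  have hcomb : c • midpoint ℝ A B + a • midpoint ℝ B C + b • midpoint ℝ C A -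
      (c + a + b) • (3 : ℝ)⁻¹ • (A + B + C) =
      ((c + a - 2 * b) / 6) • (B - A) + ((a + b - 2 * c) / 6) • (C - A) := by
    simp only [midpoint_eq_smul_add, invOf_eq_inv]
    module
  rw [hcomb]
  constructor
  · intro h0
    obtain ⟨h1, h2⟩ := hli _ _ h0
    constructor <;> linarith
  · rintro ⟨h1, h2⟩
    rw [h1, h2]
    simp [← two_mul]
end
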